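/- arXiv:2203.08231 — 8 statements merged into one kernel-verified Lean document; each statement's English description precedes it below -/
import Mathlib

section
/- Let M be a commutative additive monoid, B a commutative ring, and A a commutative B-algebra equipped with an M-grading 𝒜, and suppose A is finitely generated as a B-algebra. For a submonoid N of M let J_N denote the ideal of A generated by the union of the components 𝒜_m over all m ∈ M with m ∉ N. Then the set of ideals {J_N : N a submonoid of M} is finite. (This is the affine case of the finiteness of the set of pure magnets, i.e. of the set of attractor subspaces of a finitely presented affine scheme with diagonalizable monoid action.) -/
/-- **Finiteness of the set of pure magnets, affine case.**
Let `M` be a commutative additive monoid, `B` a commutative ring, and `A` a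
commutative `B`-algebra with an `M`-grading `𝒜`, finitely generated as a
`B`-algebra.  For a submonoid `N` of `M` let `J_N` be the ideal of `A`
generated by the components `𝒜 m` for `m ∉ N`.  Then the set of ideals
`{J_N : N a submonoid of M}` is finite. -/
theorem finite_attractor_ideals {M : Type*} [AddCommMonoid M] [DecidableEq M]
    {B : Type*} [CommRing B] {A : Type*} [CommRing A] [Algebra B A]
    (𝒜 : M → Submodule B A) [GradedAlgebra 𝒜] (hfg : Algebra.FiniteType B A) :
    (Set.range fun N : AddSubmonoid M =>
      Ideal.span (⋃ m ∈ {m : M | m ∉ N}, (𝒜 m : Set A))).Finite := by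
  classical
  obtain ⟨t, ht⟩ := hfg.out
  let F : Finset M := t.biUnion fun x => (DirectSum.decompose 𝒜 x).support
  let G : Set M → Ideal A := fun U =>
    Ideal.span {y : A | ∃ x ∈ t, ∃ m ∈ U, y = (DirectSum.decompose 𝒜 x m : A)}
  refine ((F.finite_toSet.finite_subsets).image G).subset ?_
  rintro _ ⟨N, rfl⟩
  refine ⟨{m | m ∈ F ∧ m ∉ N}, fun m hm => hm.1, ?_⟩
  apply le_antisymm
  · refine Ideal.span_le.2 ?_
    rintro y ⟨x, -, m, hm, rfl⟩
    refine Ideal.subset_span ?_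
    exact Set.mem_biUnion (show m ∈ {m : M | m ∉ N} from hm.2) (SetLike.coe_mem _)
  · have key : ∀ a : A, ∀ m, m ∉ N →
        (DirectSum.decompose 𝒜 a m : A) ∈ G {m | m ∈ F ∧ m ∉ N} := by
      intro a
      have ha : a ∈ Algebra.adjoin B (t : Set A) := by rw [ht]; trivial
      induction ha using Algebra.adjoin_induction with
      | mem x hx =>
        intro m hm
        by_cases h0 : DirectSum.decompose 𝒜 x m = 0
        · rw [h0]; simp
        · refine Ideal.subset_span ⟨x, hx, m, ⟨?_, hm⟩, rfl⟩
          exact Finset.mem_biUnion.2 ⟨x, hx, by simpa using h0⟩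
      | algebraMap r =>
        intro m hm
        have h1 : algebraMap B A r ∈ 𝒜 0 := SetLike.algebraMap_mem_graded 𝒜 r
        rw [DirectSum.decompose_of_mem_ne 𝒜 h1 (show (0 : M) ≠ m from fun h => hm (h ▸ N.zero_mem))]
        exact Ideal.zero_mem _
      | add x y _ _ hx hy =>
        intro m hm
        rw [DirectSum.decompose_add]
        simpa using Ideal.add_mem _ (hx m hm) (hy m hm)
      | mul x y _ _ hx hy =>
        intro m hm
        rw [DirectSum.decompose_mul, DirectSum.coe_mul_apply]
        refine Ideal.sum_mem _ fun p hp => ?_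
        have hp2 : p.1 + p.2 = m := (Finset.mem_filter.1 hp).2
        by_cases h1 : p.1 ∈ N
        · have h2 : p.2 ∉ N := fun h2 => hm (hp2 ▸ N.add_mem h1 h2)
          exact Ideal.mul_mem_left _ _ (hy _ h2)
        · exact Ideal.mul_mem_right _ _ (hx _ h1)
    refine Ideal.span_le.2 ?_
    intro y hy
    obtain ⟨m, hm, hy⟩ := Set.mem_iUnion₂.1 hy
    have := key y m hm
    rwa [DirectSum.decompose_of_mem_same 𝒜 hy] at this
end

section
/- Let R be a commutative ring, M a commutative additive monoid, and F an R-module equipped with an M-grading, i.e. a direct sum decomposition F = ⊕_{m∈M} F_m into R-submodules; for m ∈ M let π_m : F → F denote the R-linear projection onto the component F_m. Let f : M → F be a finitely supported function such that for all k, m ∈ M one has π_k(f(m)) = (if k = m then f(m) else 0) − (if m = 0 then f(k) else 0) (the 1-cocycle condition). Then there exists e ∈ F such that f(k) = π_k(e) − (if k = 0 then e else 0) for all k ∈ M, i.e. every 1-cocycle is a 1-coboundary. (This is the affine case of the vanishing of the first Hochschild cohomology H¹_monoid(A(M)_B, ℱ) = 0 for a quasi-coherent A(M)_B-module ℱ.)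 -/
/-- **Vanishing of first Hochschild cohomology for diagonalizable monoids,
affine case: every 1-cocycle is a 1-coboundary.**
Let `R` be a commutative ring, `M` a commutative additive monoid, and `F` an
`R`-module with an `M`-grading `ℱ`; let `π m` be the projection onto the
component `ℱ m` (given by the decomposition).  Let `f : M →₀ F` be a finitely
supported function satisfying the 1-cocycle condition
`π k (f m) = (if k = m then f m else 0) − (if m = 0 then f k else 0)` for all
`k, m ∈ M`.  Then there exists `e ∈ F` with
`f k = π k e − (if k = 0 then e else 0)` for all `k ∈ M`. -/
theorem monoid_cocycle_is_coboundary {R : Type*} [CommRing R]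
    {M : Type*} [AddCommMonoid M] [DecidableEq M]
    {F : Type*} [AddCommGroup F] [Module R F]
    (ℱ : M → Submodule R F) [DirectSum.Decomposition ℱ]
    (f : M →₀ F)
    (hf : ∀ k m : M, ((DirectSum.decompose ℱ (f m)) k : F) =
        (if k = m then f m else 0) - (if m = 0 then f k else 0)) :
    ∃ e : F, ∀ k : M,
      f k = ((DirectSum.decompose ℱ e) k : F) - (if k = 0 then e else 0) := by
  refine ⟨-f 0, fun k => ?_⟩
  have h := hf k 0
  have hn : ((DirectSum.decompose ℱ (-f 0)) k : F) = -((DirectSum.decompose ℱ (f 0)) k : F) := by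
    rw [DirectSum.decompose_neg]
    exact congrArg Subtype.val (DFinsupp.neg_apply (DirectSum.decompose ℱ (f 0)) k)
  rw [hn, h]
  by_cases hk : k = 0
  · subst hk
    simp
  · simp [hk]
end

section
/- Let N ⊆ L ⊆ L' be submonoids of a commutative additive monoid M, and assume L is a face of L'. Set N' := L' \ (L \ N). Then: (a) N' is a submonoid of M and N is a face of N'; (b) for every commutative ring R, the ring homomorphism R[N'] → R[L'] × R[N], whose first component is induced by the inclusion N' ⊆ L' (sending X^{n'} to X^{n'}) and whose second component is the face projection onto R[N] (sending X^{n'} to X^{n'} if n' ∈ N and to 0 otherwise), is injective and its range is exactly the set of pairs (u, v) with p(u) = q(v), where p : R[L'] → R[L] is the face projection (keeping exactly the coefficients supported on L) and q : R[N] → R[L] is induced by the inclusion N ⊆ L. In other words, R[N'] is the fiber product R[L'] ×_{R[L]} R[N]. -/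
/-- Inclusion map on monoid algebras, with its coefficients. -/
lemma exists_incl {M : Type*} [AddCommMonoid M] (A B : AddSubmonoid M) (h : A ≤ B)
    (R : Type*) [CommRing R] :
    ∃ q : AddMonoidAlgebra R ↥A →+* AddMonoidAlgebra R ↥B,
      (∀ (z : ↥A) (r : R), q (AddMonoidAlgebra.single z r) =
        AddMonoidAlgebra.single (⟨(z : M), h z.2⟩ : ↥B) r) ∧
      (∀ (v : AddMonoidAlgebra R ↥A) (m : M) (hA : m ∈ A) (hB : m ∈ B),
        (q v).coeff ⟨m, hB⟩ = v.coeff ⟨m, hA⟩) ∧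
      (∀ (v : AddMonoidAlgebra R ↥A) (m : M) (_ : m ∉ A) (hB : m ∈ B),
        (q v).coeff ⟨m, hB⟩ = 0) := by
  classical
  have hs : ∀ (z : ↥A) (r : R),
      AddMonoidAlgebra.mapDomainRingHom R (AddSubmonoid.inclusion h)
        (AddMonoidAlgebra.single z r) =
        AddMonoidAlgebra.single (⟨(z : M), h z.2⟩ : ↥B) r := by
    intro z r
    simp [AddMonoidAlgebra.mapDomain_single]
    rfl
  refine ⟨AddMonoidAlgebra.mapDomainRingHom R (AddSubmonoid.inclusion h), hs, ?_, ?_⟩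
  · intro v m hA hB
    induction v using AddMonoidAlgebra.induction_linear with
    | zero => rw [map_zero]; rfl
    | add f g hf hg =>
      rw [map_add, AddMonoidAlgebra.coeff_add, AddMonoidAlgebra.coeff_add,
        Finsupp.add_apply, Finsupp.add_apply, hf, hg]
    | single z r =>
      rw [hs, AddMonoidAlgebra.coeff_single, AddMonoidAlgebra.coeff_single,
        Finsupp.single_apply, Finsupp.single_apply]
      simp only [Subtype.ext_iff]
  · intro v m hA hB
    induction v using AddMonoidAlgebra.induction_linear with
    | zero => rw [map_zero]; rfl
    | add f g hf hg =>
      rw [map_add, AddMonoidAlgebra.coeff_add, Finsupp.add_apply, hf, hg, add_zero]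
    | single z r =>
      rw [hs, AddMonoidAlgebra.coeff_single, Finsupp.single_apply, if_neg]
      intro e
      have hzm : (z : M) = m := congrArg Subtype.val e
      exact hA (hzm ▸ z.2)

/-- Face projection, with its coefficients. -/
lemma exists_proj {M : Type*} [AddCommMonoid M] (F B : AddSubmonoid M) (h : F ≤ B)
    (hface : ∀ x y : M, x ∈ B → y ∈ B → (x + y ∈ F ↔ x ∈ F ∧ y ∈ F))
    (R : Type*) [CommRing R] :
    ∃ p : AddMonoidAlgebra R ↥B →+* AddMonoidAlgebra R ↥F,
      (∀ (y : ↥B) (r : R) (hy : (y : M) ∈ F), p (AddMonoidAlgebra.single y r) =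
        AddMonoidAlgebra.single (⟨(y : M), hy⟩ : ↥F) r) ∧
      (∀ (y : ↥B) (r : R), (y : M) ∉ F → p (AddMonoidAlgebra.single y r) = 0) ∧
      (∀ (v : AddMonoidAlgebra R ↥B) (m : M) (hF : m ∈ F) (hB : m ∈ B),
        (p v).coeff ⟨m, hF⟩ = v.coeff ⟨m, hB⟩) := by
  classical
  let f : Multiplicative ↥B →* AddMonoidAlgebra R ↥F :=
    { toFun := fun x => if hx : ((Multiplicative.toAdd x : ↥B) : M) ∈ F then
        AddMonoidAlgebra.single (⟨_, hx⟩ : ↥F) 1 else 0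
      map_one' := by
        rw [dif_pos (show ((Multiplicative.toAdd (1 : Multiplicative ↥B) : ↥B) : M) ∈ F
          from F.zero_mem)]
        rfl
      map_mul' := by
        intro x y
        have key : ((Multiplicative.toAdd (x * y) : ↥B) : M) ∈ F ↔ _ :=
          hface _ _ (Multiplicative.toAdd x).2 (Multiplicative.toAdd y).2
        by_cases hx : ((Multiplicative.toAdd x : ↥B) : M) ∈ F
        · by_cases hy : ((Multiplicative.toAdd y : ↥B) : M) ∈ F
          · rw [dif_pos hx, dif_pos hy, dif_pos (key.2 ⟨hx, hy⟩),
              AddMonoidAlgebra.single_mul_single, one_mul]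
            rfl
          · rw [dif_neg hy, mul_zero, dif_neg (fun hh => hy (key.1 hh).2)]
        · rw [dif_neg hx, zero_mul, dif_neg (fun hh => hx (key.1 hh).1)] }
  have h1 : ∀ (y : ↥B) (r : R) (hy : (y : M) ∈ F),
      AddMonoidAlgebra.lift R (AddMonoidAlgebra R ↥F) ↥B f (AddMonoidAlgebra.single y r) =
        AddMonoidAlgebra.single (⟨(y : M), hy⟩ : ↥F) r := by
    intro y r hy
    have : f (Multiplicative.ofAdd y) = AddMonoidAlgebra.single (⟨(y : M), hy⟩ : ↥F) 1 :=
      dif_pos hy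
    rw [AddMonoidAlgebra.lift_single, this]
    simp
  have h0 : ∀ (y : ↥B) (r : R) (hy : (y : M) ∉ F),
      AddMonoidAlgebra.lift R (AddMonoidAlgebra R ↥F) ↥B f (AddMonoidAlgebra.single y r) = 0 := by
    intro y r hy
    have : f (Multiplicative.ofAdd y) = 0 := dif_neg hy
    rw [AddMonoidAlgebra.lift_single, this, smul_zero]
  refine ⟨(AddMonoidAlgebra.lift R (AddMonoidAlgebra R ↥F) ↥B f).toRingHom, h1, h0, ?_⟩
  intro v m hF hB
  change (AddMonoidAlgebra.lift R (AddMonoidAlgebra R ↥F) ↥B f v).coeff _ = _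
  induction v using AddMonoidAlgebra.induction_linear with
  | zero => rw [map_zero]; rfl
  | add f g hf hg =>
    rw [map_add, AddMonoidAlgebra.coeff_add, AddMonoidAlgebra.coeff_add,
      Finsupp.add_apply, Finsupp.add_apply, hf, hg]
  | single z r =>
    by_cases hz : (z : M) ∈ F
    · rw [h1 z r hz, AddMonoidAlgebra.coeff_single, AddMonoidAlgebra.coeff_single,
        Finsupp.single_apply, Finsupp.single_apply]
      simp only [Subtype.ext_iff]
    · rw [h0 z r hz, AddMonoidAlgebra.coeff_single, Finsupp.single_apply, if_neg]
      · rfl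
      · intro e
        rw [Subtype.ext_iff] at e
        exact hz (e ▸ hF)

/-- **Push-out along a face (affine case): `R[N']` is the fiber product
`R[L'] ×_{R[L]} R[N]`.**
Let `N ⊆ L ⊆ L'` be submonoids of a commutative additive monoid `M`, with `L`
a face of `L'`.  Set `N' := L' \ (L \ N)`.  Then `N'` is a submonoid of `M`,
`N` is a face of `N'`, and for every commutative ring `R`, the ring
homomorphism `R[N'] → R[L'] × R[N]` — whose first component is induced by the
inclusion `N' ⊆ L'` and whose second component is the face projection onto
`R[N]` — is injective with range exactly `{(u, v) | p u = q v}`, where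
`p : R[L'] → R[L]` is the face projection and `q : R[N] → R[L]` is induced by
the inclusion `N ⊆ L`. -/
theorem monoidAlgebra_face_pushout {M : Type*} [AddCommMonoid M]
    (N L L' : AddSubmonoid M) (hNL : N ≤ L) (hLL' : L ≤ L')
    (hface : ∀ x y : M, x ∈ L' → y ∈ L' → (x + y ∈ L ↔ x ∈ L ∧ y ∈ L)) :
    ∃ N' : AddSubmonoid M,
      (N' : Set M) = (L' : Set M) \ ((L : Set M) \ (N : Set M)) ∧
      ∃ hN'L' : N' ≤ L', N ≤ N' ∧
        (∀ x y : M, x ∈ N' → y ∈ N' → (x + y ∈ N ↔ x ∈ N ∧ y ∈ N)) ∧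
        ∀ (R : Type*) [CommRing R],
          ∃ (φ : AddMonoidAlgebra R ↥N' →+* AddMonoidAlgebra R ↥L' × AddMonoidAlgebra R ↥N)
            (p : AddMonoidAlgebra R ↥L' →+* AddMonoidAlgebra R ↥L)
            (q : AddMonoidAlgebra R ↥N →+* AddMonoidAlgebra R ↥L),
            (∀ (x : ↥N') (r : R), (φ (AddMonoidAlgebra.single x r)).1 =
                AddMonoidAlgebra.single (⟨(x : M), hN'L' x.2⟩ : ↥L') r) ∧
            (∀ (x : ↥N') (r : R) (hx : (x : M) ∈ N),
                (φ (AddMonoidAlgebra.single x r)).2 =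
                  AddMonoidAlgebra.single (⟨(x : M), hx⟩ : ↥N) r) ∧
            (∀ (x : ↥N') (r : R), (x : M) ∉ N →
                (φ (AddMonoidAlgebra.single x r)).2 = 0) ∧
            (∀ (y : ↥L') (r : R) (hy : (y : M) ∈ L),
                p (AddMonoidAlgebra.single y r) =
                  AddMonoidAlgebra.single (⟨(y : M), hy⟩ : ↥L) r) ∧
            (∀ (y : ↥L') (r : R), (y : M) ∉ L →
                p (AddMonoidAlgebra.single y r) = 0) ∧
            (∀ (z : ↥N) (r : R), q (AddMonoidAlgebra.single z r) =
                AddMonoidAlgebra.single (⟨(z : M), hNL z.2⟩ : ↥L) r) ∧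
            Function.Injective φ ∧
            Set.range φ =
              {uv : AddMonoidAlgebra R ↥L' × AddMonoidAlgebra R ↥N | p uv.1 = q uv.2} := by
  classical
  let N' : AddSubmonoid M :=
    { carrier := (L' : Set M) \ ((L : Set M) \ (N : Set M))
      zero_mem' := ⟨L'.zero_mem, fun h => h.2 N.zero_mem⟩
      add_mem' := by
        rintro a b ⟨ha, ha'⟩ ⟨hb, hb'⟩
        refine ⟨L'.add_mem ha hb, fun h => h.2 ?_⟩
        obtain ⟨h1, h2⟩ := (hface a b ha hb).1 h.1
        exact N.add_mem (by_contra fun hc => ha' ⟨h1, hc⟩) (by_contra fun hc => hb' ⟨h2, hc⟩) }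
  have hN'L' : N' ≤ L' := fun x hx => hx.1
  have hNN' : N ≤ N' := fun x hx => ⟨hLL' (hNL hx), fun h => h.2 hx⟩
  have hmem : ∀ x, x ∈ N' → x ∈ L → x ∈ N := fun x hx hl => by_contra fun hc => hx.2 ⟨hl, hc⟩
  have hf' : ∀ x y : M, x ∈ N' → y ∈ N' → (x + y ∈ N ↔ x ∈ N ∧ y ∈ N) := by
    intro x y hx hy
    refine ⟨fun h => ?_, fun h => N.add_mem h.1 h.2⟩
    obtain ⟨h1, h2⟩ := (hface x y hx.1 hy.1).1 (hNL h)
    exact ⟨hmem x hx h1, hmem y hy h2⟩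
  refine ⟨N', rfl, hN'L', hNN', hf', ?_⟩
  intro R _
  obtain ⟨i, i1, i2, i3⟩ := exists_incl N' L' hN'L' R
  obtain ⟨q, q1, q2, q3⟩ := exists_incl N L hNL R
  obtain ⟨p, p1, p2, p3⟩ := exists_proj L L' hLL' hface R
  obtain ⟨s, s1, s2, s3⟩ := exists_proj N N' hNN' hf' R
  refine ⟨i.prod s, p, q, i1, s1, s2, p1, p2, q1, ?_, ?_⟩
  · intro a b hab
    have hab1 : i a = i b := congrArg Prod.fst hab
    ext ⟨m, hm⟩
    rw [← i2 a m hm (hN'L' hm), ← i2 b m hm (hN'L' hm), hab1]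
  · ext ⟨u, v⟩
    constructor
    · rintro ⟨w, hw⟩
      obtain ⟨rfl, rfl⟩ : i w = u ∧ s w = v := ⟨congrArg Prod.fst hw, congrArg Prod.snd hw⟩
      change p (i w) = q (s w)
      ext ⟨m, hm⟩
      rw [p3 _ m hm (hLL' hm)]
      by_cases hn : m ∈ N
      · rw [i2 w m (hNN' hn), q2 _ m hn, s3 w m hn (hNN' hn)]
      · rw [i3 w m (fun h => hn (hmem m h hm)), q3 _ m hn]
    · intro huv
      change p u = q v at huv
      let w : AddMonoidAlgebra R ↥N' := AddMonoidAlgebra.ofCoeff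
        (u.coeff.comapDomain (AddSubmonoid.inclusion hN'L')
          (AddSubmonoid.inclusion_injective hN'L').injOn)
      have hw : ∀ m (hm : m ∈ N'), w.coeff ⟨m, hm⟩ = u.coeff ⟨m, hN'L' hm⟩ := fun _ _ => rfl
      refine ⟨w, Prod.ext ?_ ?_⟩
      · change i w = u
        ext ⟨m, hm⟩
        by_cases hn : m ∈ N'
        · rw [i2 w m hn, hw]
        · have hl : m ∈ L := by_contra fun hc => hn ⟨hm, fun h => hc h.1⟩
          rw [i3 w m hn, ← p3 u m hl hm, huv, q3 v m (fun h => hn (hNN' h))]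
      · change s w = v
        ext ⟨m, hm⟩
        rw [s3 w m hm (hNN' hm), hw, ← p3 u m (hNL hm), huv, q2 v m hm]
end

section
/- If N is a finitely generated commutative additive monoid, then the monoid algebra ℤ[N] is a finitely presented ℤ-algebra (Algebra.FinitePresentation ℤ (AddMonoidAlgebra ℤ N)). -/
/-- If `N` is a finitely generated commutative additive monoid, then the monoid
algebra `ℤ[N]` is a finitely presented `ℤ`-algebra. -/
theorem finitePresentation_addMonoidAlgebra_of_fg (N : Type*) [AddCommMonoid N]
    [AddMonoid.FG N] :
    Algebra.FinitePresentation ℤ (AddMonoidAlgebra ℤ N) := by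
  exact Algebra.FinitePresentation.of_finiteType.mp inferInstance
end

section
/- Let n ≥ 1. The additive monoid ℤ^n (for instance realized as Fin n → ℤ) admits a set of n + 1 elements generating it as an additive monoid (namely the standard basis vectors e_1, …, e_n together with −(e_1 + ⋯ + e_n)), and every subset S ⊆ ℤ^n whose generated additive submonoid (AddSubmonoid.closure S) is all of ℤ^n has cardinality at least n + 1. Hence the minimal cardinality of a monoid generating set of ℤ^n is exactly n + 1. -/
/-- **The monoid rank of `ℤ^n` is `n + 1`.**
For `n ≥ 1`, the additive monoid `ℤ^n` (realized as `Fin n → ℤ`) admits a set of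
`n + 1` elements generating it as an additive monoid, and every subset
`S ⊆ ℤ^n` whose generated additive submonoid is all of `ℤ^n` has cardinality
at least `n + 1`.  Hence the minimal cardinality of a monoid generating set of
`ℤ^n` is exactly `n + 1`. -/
theorem monoid_rank_int_pow (n : ℕ) (hn : 1 ≤ n) :
    (∃ S : Finset (Fin n → ℤ), S.card = n + 1 ∧
        AddSubmonoid.closure (S : Set (Fin n → ℤ)) = ⊤) ∧
    (∀ S : Set (Fin n → ℤ), AddSubmonoid.closure S = ⊤ →
        ((n : Cardinal) + 1 ≤ Cardinal.mk S)) := by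
  classical
  constructor
  · refine ⟨insert (fun _ => -1) (Finset.univ.image fun i : Fin n => Pi.single i (1 : ℤ)), ?_, ?_⟩
    · rw [Finset.card_insert_of_notMem, Finset.card_image_of_injective, Finset.card_univ,
        Fintype.card_fin]
      · intro i j h
        by_contra hij
        have := congrFun h i
        simp [hij] at this
      · intro h
        obtain ⟨i, -, hi⟩ := Finset.mem_image.1 h
        have := congrFun hi i
        simp at this
    · rw [eq_top_iff]
      intro x _
      set C := AddSubmonoid.closure
        ((insert (fun _ => -1) (Finset.univ.image fun i : Fin n => Pi.single i (1 : ℤ)) :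
          Finset (Fin n → ℤ)) : Set (Fin n → ℤ)) with hC
      have h1 : (fun _ => -1 : Fin n → ℤ) ∈ C := AddSubmonoid.subset_closure (by simp)
      have h2 : ∀ i, (Pi.single i (1 : ℤ) : Fin n → ℤ) ∈ C := fun i =>
        AddSubmonoid.subset_closure (by simp)
      have key : x = (∑ i, |x i|).toNat • (fun _ => -1 : Fin n → ℤ) +
          ∑ i, (x i + ∑ j, |x j|).toNat • (Pi.single i (1 : ℤ) : Fin n → ℤ) := by
        ext k
        have h0 : 0 ≤ ∑ j, |x j| := Finset.sum_nonneg fun j _ => abs_nonneg _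
        have hk : |x k| ≤ ∑ j, |x j| :=
          Finset.single_le_sum (f := fun j => |x j|) (fun j _ => abs_nonneg _) (Finset.mem_univ k)
        have hkn := neg_abs_le (x k)
        have h3 : 0 ≤ x k + ∑ j, |x j| := by linarith
        simp only [Pi.add_apply, Pi.smul_apply, Finset.sum_apply, Pi.single_apply]
        simp only [nsmul_eq_mul, mul_ite, mul_one, mul_zero, Finset.sum_ite_eq, Finset.mem_univ, if_true]
        rw [Int.toNat_of_nonneg h0, Int.toNat_of_nonneg h3]
        ring
      rw [key]
      exact add_mem (nsmul_mem h1 _) (sum_mem fun i _ => nsmul_mem (h2 i) _)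
  · intro S hS
    by_contra hlt
    rw [not_le] at hlt
    have hle : Cardinal.mk S ≤ n := by
      have : Cardinal.mk S < Order.succ (n : Cardinal) := by
        rwa [Cardinal.succ_natCast]
      exact Order.lt_succ_iff.1 this
    have hfin : Finite S := Cardinal.lt_aleph0_iff_finite.1 (hle.trans_lt (Cardinal.natCast_lt_aleph0))
    have := Fintype.ofFinite S
    have hne : Nonempty S := by
      by_contra h
      have hS0 : S = ∅ := Set.not_nonempty_iff_eq_empty.1 fun hs => h hs.to_subtype
      rw [hS0, AddSubmonoid.closure_empty] at hS
      have hm : (fun _ => 1 : Fin n → ℤ) ∈ (⊥ : AddSubmonoid (Fin n → ℤ)) := hS ▸ AddSubmonoid.mem_top _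
      have := congrFun (AddSubmonoid.mem_bot.1 hm) ⟨0, hn⟩
      simp at this
    have hcard : Fintype.card S ≤ Fintype.card (Fin n) := by
      rw [Cardinal.mk_fintype] at hle
      simpa using hle
    obtain ⟨e⟩ := Function.Embedding.nonempty_of_card_le hcard
    let f : (S → ℤ) →ₗ[ℤ] (Fin n → ℤ) := Fintype.linearCombination ℤ (fun s : S => (s : Fin n → ℤ))
    have hpos : ∀ x : Fin n → ℤ, ∃ c : S → ℤ, (∀ s, 0 ≤ c s) ∧ f c = x := by
      intro x
      have hx : x ∈ AddSubmonoid.closure S := hS ▸ AddSubmonoid.mem_top _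
      induction hx using AddSubmonoid.closure_induction with
      | mem x hx =>
        refine ⟨Pi.single ⟨x, hx⟩ 1, fun s => ?_, ?_⟩
        · rw [Pi.single_apply]; split_ifs <;> norm_num
        · simp [f, Fintype.linearCombination_apply_single]
      | zero => exact ⟨0, fun s => le_rfl, map_zero f⟩
      | add x y _ _ hx hy =>
        obtain ⟨c, hc, rfl⟩ := hx
        obtain ⟨d, hd, rfl⟩ := hy
        exact ⟨c + d, fun s => add_nonneg (hc s) (hd s), map_add f c d⟩
    have hsurj : Function.Surjective f := fun x => (hpos x).imp fun c h => h.2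
    have hinj : Function.Injective f :=
      OrzechProperty.injective_of_surjective_of_injective
        (LinearMap.funLeft ℤ ℤ (Function.invFun e)) f
        (LinearMap.funLeft_injective_of_surjective ℤ ℤ _ (Function.invFun_surjective e.injective))
        hsurj
    obtain ⟨c, hc, hfc⟩ := hpos (f (fun _ => -1))
    have := hinj hfc
    obtain ⟨s⟩ := hne
    have h := hc s
    rw [this] at h
    norm_num at h
end

section
/- Let N be a commutative additive monoid and h : N → ℕ an additive monoid homomorphism such that h(n) = 0 implies n = 0 (such an h exists whenever N is fine and sharp). Let A be a commutative ring equipped with an N-grading 𝒜 (a GradedRing structure A = ⊕_{n∈N} 𝒜_n), and let I be the ideal of A generated by the union of the components 𝒜_n over all n ≠ 0. Let S be a subset of A such that for every n ≠ 0 and every a ∈ 𝒜_n there exists a' ∈ S ∩ 𝒜_n with a − a' ∈ I². Then the subring of A generated by 𝒜_0 ∪ S is all of A. (This is the surjectivity step, proved by induction on h of the degree, in the generalized Bialynicki-Birula theorem that X^N → X^{N*} is a vector bundle for smooth X.) -/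
/-- **Surjectivity step in the generalized Bialynicki-Birula theorem.**
Let `N` be a commutative additive monoid and `h : N → ℕ` an additive monoid
homomorphism with `h n = 0 → n = 0` (such an `h` exists when `N` is fine and
sharp).  Let `A` be a commutative ring with an `N`-grading `𝒜`, and let `I` be
the ideal generated by the components `𝒜 n` for `n ≠ 0`.  Let `S ⊆ A` be such
that for every `n ≠ 0` and `a ∈ 𝒜 n` there is `a' ∈ S ∩ 𝒜 n` with
`a − a' ∈ I²`.  Then the subring of `A` generated by `𝒜 0 ∪ S` is all of
`A`. -/
theorem subring_closure_eq_top_of_graded_sections {N : Type*} [AddCommMonoid N]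
    [DecidableEq N] (h : N →+ ℕ) (hh : ∀ x : N, h x = 0 → x = 0)
    {A : Type*} [CommRing A] (𝒜 : N → AddSubgroup A) [GradedRing 𝒜]
    (S : Set A)
    (hS : ∀ n : N, n ≠ 0 → ∀ a ∈ 𝒜 n, ∃ a' ∈ S ∩ (𝒜 n : Set A),
        a - a' ∈ (Ideal.span (⋃ n ∈ {n : N | n ≠ 0}, (𝒜 n : Set A))) ^ 2) :
    Subring.closure ((𝒜 0 : Set A) ∪ S) = ⊤ := by
  classical
  set R := Subring.closure ((𝒜 0 : Set A) ∪ S) with hR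
  set G : Set A := ⋃ n ∈ {n : N | n ≠ 0}, (𝒜 n : Set A) with hG
  have memG : ∀ x, x ∈ G ↔ ∃ p, p ≠ 0 ∧ x ∈ 𝒜 p := by
    intro x
    simp [hG]
  have hI : ∀ x ∈ Ideal.span G, x ∈ AddSubgroup.closure G := by
    intro x hx
    induction hx using Submodule.span_induction with
    | mem x hx => exact AddSubgroup.subset_closure hx
    | zero => exact zero_mem _
    | add x y _ _ hx hy => exact add_mem hx hy
    | smul a x hx0 hx =>
      rw [smul_eq_mul]
      clear hx0
      induction hx using AddSubgroup.closure_induction with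
      | zero => simp
      | add x y _ _ hx hy => rw [mul_add]; exact add_mem hx hy
      | neg x _ hx => rw [mul_neg]; exact neg_mem hx
      | mem x hx =>
        obtain ⟨p, hp, hx⟩ := (memG x).1 hx
        induction a using DirectSum.Decomposition.inductionOn 𝒜 with
        | zero => simp
        | add a b ha hb => rw [add_mul]; exact add_mem ha hb
        | @homogeneous m a =>
          refine AddSubgroup.subset_closure ((memG _).2 ⟨m + p, ?_, SetLike.mul_mem_graded a.2 hx⟩)
          intro h0
          apply hp
          apply hh
          have := congrArg h h0
          rw [map_add, map_zero] at this
          omega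
  have key : ∀ k : ℕ, ∀ n, h n = k → ∀ a ∈ 𝒜 n, a ∈ R := by
    intro k
    induction k using Nat.strong_induction_on with
    | _ k ih =>
    intro n hn a ha
    by_cases h0 : n = 0
    · subst h0
      exact Subring.subset_closure (Or.inl ha)
    obtain ⟨a', ⟨haS, ha'⟩, hsub⟩ := hS n h0 a ha
    have comp : ∀ x ∈ (Ideal.span G) ^ 2, (DirectSum.decompose 𝒜 x n : A) ∈ R := by
      intro x hx
      rw [pow_two] at hx
      induction hx using Submodule.mul_induction_on' with
      | add x _ y _ hx hy =>
        rw [DirectSum.decompose_add]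
        exact add_mem hx hy
      | mem_mul_mem x hx y hy =>
        replace hx := hI x hx
        replace hy := hI y hy
        induction hx using AddSubgroup.closure_induction with
        | zero => simp
        | add x z _ _ hx hz =>
          rw [add_mul, DirectSum.decompose_add]; exact add_mem hx hz
        | neg x _ hx => rw [neg_mul, DirectSum.decompose_neg]; exact neg_mem hx
        | mem x hx =>
          induction hy using AddSubgroup.closure_induction with
          | zero => simp
          | add y z _ _ hy hz =>
            rw [mul_add, DirectSum.decompose_add]; exact add_mem hy hz
          | neg y _ hy => rw [mul_neg, DirectSum.decompose_neg]; exact neg_mem hy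
          | mem y hy =>
            obtain ⟨p, hp, hx⟩ := (memG x).1 hx
            obtain ⟨q, hq, hy⟩ := (memG y).1 hy
            have hxy : x * y ∈ 𝒜 (p + q) := SetLike.mul_mem_graded hx hy
            by_cases e : p + q = n
            · subst e
              rw [DirectSum.decompose_of_mem_same 𝒜 hxy]
              have h1 : h p ≠ 0 := fun t => hp (hh p t)
              have h2 : h q ≠ 0 := fun t => hq (hh q t)
              rw [map_add] at hn
              exact mul_mem (ih (h p) (by omega) p rfl x hx) (ih (h q) (by omega) q rfl y hy)
            · rw [DirectSum.decompose_of_mem_ne 𝒜 hxy e]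
              exact zero_mem _
    have h1 := comp _ hsub
    rw [DirectSum.decompose_of_mem_same 𝒜 (sub_mem ha ha')] at h1
    have h2 : a' ∈ R := Subring.subset_closure (Or.inr haS)
    simpa using add_mem h1 h2
  rw [eq_top_iff]
  intro x _
  induction x using DirectSum.Decomposition.inductionOn 𝒜 with
  | zero => exact zero_mem _
  | add a b ha hb => exact add_mem (ha trivial) (hb trivial)
  | @homogeneous m a => exact key _ m rfl a a.2
end

section
/- Let A be a commutative ring, I an ideal of A, and n a natural number. Suppose that for each k with 0 ≤ k ≤ n we are given an additive map ψ_k : A → A such that ψ_k vanishes on I^{k+1} and such that for every x ∈ I^k one has ψ_k(x) ∈ I^k and ψ_k(x) − x ∈ I^{k+1}. If x_0, …, x_n are elements with x_k ∈ I^k for each k and Σ_{k=0}^{n} ψ_k(x_k) = 0, then x_k ∈ I^{k+1} for every k with 0 ≤ k ≤ n. (This is the injectivity step — the injectivity of the induced map from the associated graded ring ⊕_k I^k/I^{k+1} to A determined by a family of splittings — in the proof of the generalized Bialynicki-Birula theorem.) -/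
/-- **Injectivity step of the generalized Bialynicki-Birula theorem.**
Let `A` be a commutative ring, `I` an ideal of `A`, and `n` a natural number.
Suppose that for each `k ≤ n` we are given an additive map `ψ k : A → A` which
vanishes on `I^(k+1)` and such that for every `x ∈ I^k` one has `ψ k x ∈ I^k`
and `ψ k x − x ∈ I^(k+1)`.  If `x₀, …, xₙ` are elements with `x k ∈ I^k` and
`Σ_{k=0}^{n} ψ k (x k) = 0`, then `x k ∈ I^(k+1)` for every `k ≤ n`. -/
theorem assoc_graded_sections_injective {A : Type*} [CommRing A] (I : Ideal A) (n : ℕ)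
    (ψ : ℕ → A →+ A)
    (hvanish : ∀ k ≤ n, ∀ x ∈ I ^ (k + 1), ψ k x = 0)
    (hmem : ∀ k ≤ n, ∀ x ∈ I ^ k, ψ k x ∈ I ^ k)
    (hmod : ∀ k ≤ n, ∀ x ∈ I ^ k, ψ k x - x ∈ I ^ (k + 1))
    (x : ℕ → A) (hx : ∀ k ≤ n, x k ∈ I ^ k)
    (hsum : ∑ k ∈ Finset.range (n + 1), ψ k (x k) = 0) :
    ∀ k ≤ n, x k ∈ I ^ (k + 1) := by
  intro k
  induction k using Nat.strong_induction_on with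
  | _ k ih =>
    intro hk
    have hrest : ∑ j ∈ (Finset.range (n + 1)).erase k, ψ j (x j) ∈ I ^ (k + 1) := by
      refine Ideal.sum_mem _ fun j hj => ?_
      rw [Finset.mem_erase, Finset.mem_range] at hj
      have hjn : j ≤ n := by omega
      rcases lt_or_gt_of_ne hj.1 with h | h
      · rw [hvanish j hjn _ (ih j h hjn)]
        exact Submodule.zero_mem _
      · exact Ideal.pow_le_pow_right h (hmem j hjn _ (hx j hjn))
    have hk' : k ∈ Finset.range (n + 1) := Finset.mem_range.2 (by omega)
    rw [← Finset.add_sum_erase _ _ hk'] at hsum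
    have h1 : x k = -(∑ j ∈ (Finset.range (n + 1)).erase k, ψ j (x j)) - (ψ k (x k) - x k) := by
      linear_combination hsum
    rw [h1]
    exact Submodule.sub_mem _ (Submodule.neg_mem _ hrest) (hmod k hk _ (hx k hk))
end

section
/- Let R be a commutative ring and A a commutative R-algebra. Let x_1, …, x_d be elements of A and, for each n ≥ 1, let I_n be the ideal of A generated by the powers x_1^n, …, x_d^n. If A/I_1 is finite over R (i.e. a finitely generated R-module), then A/I_n is finite over R for all n ≥ 1. -/
/-- **Lemma on cofinal thickenings (finiteness).**
Let `R` be a commutative ring and `A` a commutative `R`-algebra.  Let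
`x₁, …, x_d` be elements of `A` and, for each `n ≥ 1`, let `Iₙ` be the ideal of
`A` generated by the powers `x₁^n, …, x_d^n`.  If `A/I₁` is finite over `R`
(i.e. a finitely generated `R`-module), then `A/Iₙ` is finite over `R` for all
`n ≥ 1`. -/
theorem finite_quotient_of_powers {R A : Type*} [CommRing R] [CommRing A] [Algebra R A]
    (d : ℕ) (x : Fin d → A)
    (h1 : Module.Finite R (A ⧸ Ideal.span (Set.range fun i => x i ^ 1))) :
    ∀ n : ℕ, 1 ≤ n →
      Module.Finite R (A ⧸ Ideal.span (Set.range fun i => x i ^ n)) := by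
  intro n hn
  have hle : Ideal.span (Set.range fun i => x i ^ n) ≤
      Ideal.span (Set.range fun i => x i ^ 1) := by
    rw [Ideal.span_le]
    rintro _ ⟨i, rfl⟩
    have h : x i ^ 1 ∈ Ideal.span (Set.range fun i => x i ^ 1) :=
      Ideal.subset_span ⟨i, rfl⟩
    exact Ideal.mem_of_dvd _ (pow_dvd_pow (x i) hn) h
  have hker : RingHom.ker (Ideal.Quotient.factorₐ R hle) =
      (Ideal.span (Set.range fun i => x i ^ 1)).map
        (Ideal.Quotient.mk (Ideal.span (Set.range fun i => x i ^ n))) :=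
    Ideal.Quotient.factor_ker hle
  refine Module.finite_of_surjective_of_ker_le_nilradical
    (Ideal.Quotient.factorₐ R hle) (Ideal.Quotient.factor_surjective hle) ?_ ?_
  · rw [hker, Ideal.map_span, Ideal.span_le]
    rintro _ ⟨_, ⟨i, rfl⟩, rfl⟩
    refine mem_nilradical.mpr ⟨n, ?_⟩
    rw [← map_pow, Ideal.Quotient.eq_zero_iff_mem]
    simp only [pow_one]
    exact Ideal.subset_span ⟨i, rfl⟩
  · rw [hker]
    exact Ideal.FG.map (Submodule.fg_span (Set.finite_range _)) _
end
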